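/- Let A be a polynomial ring over a field and I ⊂ A a nonzero proper homogeneous ideal. Then min_{i ≥ 1} depth A/I^i = min_{i ≥ 1} depth I^{i−1}/I^i. -/

import Mathlib

/-! Core definitions: depth via local cohomology at the maximal homogeneous ideal,
Castelnuovo–Mumford regularity via graded free resolutions, gradings on
subquotients of polynomial rings.  -/

open MvPolynomial

noncomputable section

namespace PaperHTT

variable (k : Type) [Field k]

/-- A polynomial is homogeneous of degree `e : ℤ` (it must vanish in negative degrees). -/
def homogZ {σ : Type} (p : MvPolynomial σ k) (e : ℤ) : Prop :=
  p = 0 ∨ (0 ≤ e ∧ p.IsHomogeneous e.toNat)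

/-- The maximal homogeneous ideal `(x_1, …, x_r)` of a polynomial ring. -/
def maxHomIdeal (σ : Type) : Ideal (MvPolynomial σ k) :=
  Ideal.span (Set.range MvPolynomial.X)

/-- The depth of a module over a polynomial ring with respect to the maximal homogeneous
ideal: the least `i` such that the `i`-th local cohomology is non-vanishing. -/
def depthM {σ : Type} (M : ModuleCat (MvPolynomial σ k)) : ℕ :=
  sInf {i : ℕ | Nontrivial ((localCohomology (maxHomIdeal k σ) i).obj M)}

/-- The subquotient `p/q` of a polynomial ring, for ideals `q ≤ p`. -/
abbrev subQuot {σ : Type} (p q : Ideal (MvPolynomial σ k)) : Type :=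
  ↥p ⧸ (Submodule.comap p.subtype q)

/-- The degree-`t` graded piece of `p/q`: the image of the homogeneous elements of
degree `t` of `p`. -/
def subQuotGr {σ : Type} (p q : Ideal (MvPolynomial σ k)) (t : ℤ) :
    AddSubgroup (subQuot k p q) :=
  AddSubgroup.closure
    {x | ∃ f : p, homogZ k (f : MvPolynomial σ k) t ∧ x = Submodule.Quotient.mk f}

/-- The degree-`t` graded piece of the quotient ring `P/Q`. -/
def quotGr {σ : Type} (Q : Ideal (MvPolynomial σ k)) (t : ℤ) :
    AddSubgroup (MvPolynomial σ k ⧸ Q) :=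
  AddSubgroup.closure {x | ∃ f, homogZ k f t ∧ x = Ideal.Quotient.mk Q f}

/-- The degree-`t` graded piece of an ideal `p`, viewed as a module. -/
def idealGr {σ : Type} (p : Ideal (MvPolynomial σ k)) (t : ℤ) : AddSubgroup ↥p :=
  AddSubgroup.closure {x : p | homogZ k (x : MvPolynomial σ k) t}

/-- A finite graded free resolution of a module `M` over a polynomial ring,
with respect to a grading `gr` of `M`: `F_i` is free of rank `rk i`, with basis elements
of (twisted) degrees `tw i l`, the differentials and augmentation are graded of degree `0`,
and the complex `⋯ → F_1 → F_0 → M → 0` is exact. -/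
structure GradedFreeRes (σ : Type) (M : Type) [AddCommGroup M]
    [Module (MvPolynomial σ k) M] (gr : ℤ → AddSubgroup M) where
  rk : ℕ → ℕ
  tw : (i : ℕ) → Fin (rk i) → ℤ
  bdd : ∃ N, ∀ i, N ≤ i → rk i = 0
  aug : (Fin (rk 0) → MvPolynomial σ k) →ₗ[MvPolynomial σ k] M
  d : (i : ℕ) →
    ((Fin (rk (i + 1)) → MvPolynomial σ k) →ₗ[MvPolynomial σ k]
      (Fin (rk i) → MvPolynomial σ k))
  aug_surj : Function.Surjective aug
  exact_zero : LinearMap.range (d 0) = LinearMap.ker aug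
  exact_succ : ∀ i, LinearMap.range (d (i + 1)) = LinearMap.ker (d i)
  aug_homog : ∀ l, aug (Pi.single l 1) ∈ gr (tw 0 l)
  d_homog : ∀ i l l', homogZ k (d i (Pi.single l 1) l') (tw (i + 1) l - tw i l')

/-- The Castelnuovo–Mumford regularity of a (finitely generated) graded module over a
polynomial ring: the least `r` such that `M` admits a graded free resolution with all
twists in homological degree `i` at most `r + i`.  (By minimal free resolutions, this
agrees with `max {aⁱ(M) + i}`.) -/
def regM (σ : Type) (M : Type) [AddCommGroup M] [Module (MvPolynomial σ k) M]
    (gr : ℤ → AddSubgroup M) : ℤ :=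
  sInf {r : ℤ | ∃ F : GradedFreeRes k σ M gr, ∀ i (l : Fin (F.rk i)), F.tw i l - (i : ℤ) ≤ r}

/-- Depth of the quotient ring `P/Q` as a module over `P`. -/
def depthQuot {σ : Type} (Q : Ideal (MvPolynomial σ k)) : ℕ :=
  depthM k (ModuleCat.of (MvPolynomial σ k) (MvPolynomial σ k ⧸ Q))

/-- Depth of the subquotient `p/q` as a module over the polynomial ring. -/
def depthSubQuot {σ : Type} (p q : Ideal (MvPolynomial σ k)) : ℕ :=
  depthM k (ModuleCat.of (MvPolynomial σ k) (subQuot k p q))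

/-- Depth of an ideal `p` as a module over the polynomial ring. -/
def depthIdeal {σ : Type} (p : Ideal (MvPolynomial σ k)) : ℕ :=
  depthM k (ModuleCat.of (MvPolynomial σ k) ↥p)

/-- Regularity of the quotient ring `P/Q`. -/
def regQuot {σ : Type} (Q : Ideal (MvPolynomial σ k)) : ℤ :=
  regM k σ (MvPolynomial σ k ⧸ Q) (quotGr k Q)

/-- Regularity of the subquotient `p/q`. -/
def regSubQuot {σ : Type} (p q : Ideal (MvPolynomial σ k)) : ℤ :=
  regM k σ (subQuot k p q) (subQuotGr k p q)

/-- Regularity of an ideal `p`, viewed as a graded module. -/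
def regIdeal {σ : Type} (p : Ideal (MvPolynomial σ k)) : ℤ :=
  regM k σ (↥p) (idealGr k p)

/-- A homogeneous ideal: one containing all homogeneous components of its elements. -/
def IsHomogeneousIdeal {σ : Type} (I : Ideal (MvPolynomial σ k)) : Prop :=
  ∀ f ∈ I, ∀ m : ℕ, MvPolynomial.homogeneousComponent m f ∈ I

/-- A monomial ideal. -/
def IsMonomialIdeal {σ : Type} (I : Ideal (MvPolynomial σ k)) : Prop :=
  ∃ S : Set (σ →₀ ℕ), I = Ideal.span ((fun a => MvPolynomial.monomial a (1 : k)) '' S)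

/-- A squarefree monomial ideal. -/
def IsSquarefreeMonomialIdeal {σ : Type} (I : Ideal (MvPolynomial σ k)) : Prop :=
  ∃ S : Set (σ →₀ ℕ), (∀ a ∈ S, ∀ x, a x ≤ 1) ∧
    I = Ideal.span ((fun a => MvPolynomial.monomial a (1 : k)) '' S)


/-- The quotient ring `P/Q` is Cohen–Macaulay: its depth equals its Krull dimension. -/
def IsCMQuot {σ : Type} (Q : Ideal (MvPolynomial σ k)) : Prop :=
  (depthQuot k Q : WithBot (WithTop ℕ)) = ringKrullDim (MvPolynomial σ k ⧸ Q)

/-- An isomorphism of graded modules: a linear isomorphism matching up the gradings. -/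
def GradedIso {P : Type} [CommRing P] {M N : Type} [AddCommGroup M] [Module P M]
    [AddCommGroup N] [Module P N] (grM : ℤ → AddSubgroup M) (grN : ℤ → AddSubgroup N) :
    Prop :=
  ∃ e : M ≃ₗ[P] N, ∀ t, (grM t).map e.toLinearMap.toAddMonoidHom = grN t

/-- `gr` is an (internal, ℤ-) grading of the module `M` over a polynomial ring,
compatible with the standard grading of the polynomial ring. -/
def IsGrading (σ : Type) {M : Type} [AddCommGroup M] [Module (MvPolynomial σ k) M]
    (gr : ℤ → AddSubgroup M) : Prop :=
  DirectSum.IsInternal (fun t : ℤ => gr t) ∧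
    ∀ (p : MvPolynomial σ k) (d : ℕ) (t : ℤ) (m : M), p.IsHomogeneous d → m ∈ gr t →
      p • m ∈ gr (t + d)

/-- The polynomial ring `A = k[x_1,…,x_r]`. -/
abbrev PA (r : ℕ) : Type := MvPolynomial (Fin r) k

/-- The polynomial ring `B = k[y_1,…,y_s]`. -/
abbrev PB (s : ℕ) : Type := MvPolynomial (Fin s) k

/-- The polynomial ring `R = k[x_1,…,x_r,y_1,…,y_s]`. -/
abbrev PR (r s : ℕ) : Type := MvPolynomial (Fin r ⊕ Fin s) k

/-- The extension of an ideal `I ⊆ A` to `R`. -/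
def extA {r s : ℕ} (I : Ideal (PA k r)) : Ideal (PR k r s) :=
  I.map (MvPolynomial.rename (Sum.inl : Fin r → Fin r ⊕ Fin s))

/-- The extension of an ideal `J ⊆ B` to `R`. -/
def extB {r s : ℕ} (J : Ideal (PB k s)) : Ideal (PR k r s) :=
  J.map (MvPolynomial.rename (Sum.inr : Fin s → Fin r ⊕ Fin s))

/-- The ideal `I + J ⊆ R`. -/
def sumIJ {r s : ℕ} (I : Ideal (PA k r)) (J : Ideal (PB k s)) : Ideal (PR k r s) :=
  extA k I + extB k J

end PaperHTT

end

section

open CategoryTheory Limits Opposite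

namespace HomologicalComplex

universe u
variable {R : Type u} [CommRing R] {ι : Type*} {c : ComplexShape ι}

/-- For a complex `K` in the opposite of a module category, the class `e` in the (unopposed)
homology is represented by the cocycle `x`. -/
def Represents (K : HomologicalComplex (ModuleCat.{u} R)ᵒᵖ c) (n : ι)
    (x : (K.X n).unop) (e : (K.homology n).unop) : Prop :=
  ∃ z : (K.opcycles n).unop, (K.pOpcycles n).unop z = x ∧ (K.homologyι n).unop z = e

variable (K L : HomologicalComplex (ModuleCat.{u} R)ᵒᵖ c) (n : ι)

lemma exists_represents (e : (K.homology n).unop) : ∃ x, K.Represents n x e := by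
  have h : Epi (K.homologyι n).unop := inferInstance
  obtain ⟨z, hz⟩ := (ModuleCat.epi_iff_surjective _).1 h e
  exact ⟨_, z, rfl, hz⟩

variable {K L n}

lemma Represents.d_eq_zero {x : (K.X n).unop} {e : (K.homology n).unop}
    (h : K.Represents n x e) (m : ι) : (K.d m n).unop x = 0 := by
  obtain ⟨z, rfl, -⟩ := h
  rw [← ModuleCat.comp_apply, ← unop_comp, K.d_pOpcycles]
  rfl

lemma exists_of_d_eq_zero {x : (K.X n).unop} (hx : (K.d (c.prev n) n).unop x = 0) :
    ∃ e, K.Represents n x e := by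
  have ex : (ShortComplex.mk (K.d (c.prev n) n) (K.pOpcycles n) (by simp)).Exact :=
    ShortComplex.exact_of_g_is_cokernel _ (K.opcyclesIsCokernel _ n rfl)
  obtain ⟨z, hz⟩ := (ShortComplex.moduleCat_exact_iff _).1 ex.unop x hx
  exact ⟨_, z, hz, rfl⟩

lemma Represents.eq_zero_iff {x : (K.X n).unop} {e : (K.homology n).unop}
    (h : K.Represents n x e) :
    e = 0 ↔ ∃ y : (K.X (c.next n)).unop, (K.d n (c.next n)).unop y = x := by
  have mono : Mono (K.homologyπ n).unop := inferInstance
  have inj := (ModuleCat.mono_iff_injective _).1 mono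
  obtain ⟨z, rfl, rfl⟩ := h
  have key : (K.homologyπ n).unop ((K.homologyι n).unop z) =
      (K.iCycles n).unop ((K.pOpcycles n).unop z) := by
    rw [← ModuleCat.comp_apply, ← ModuleCat.comp_apply, ← unop_comp, ← unop_comp,
      K.homology_π_ι]
  have ex : (ShortComplex.mk (K.iCycles n) (K.d n (c.next n)) (by simp)).Exact :=
    ShortComplex.exact_of_f_is_kernel _ (K.cyclesIsKernel n _ rfl)
  constructor
  · intro h0
    rw [h0, map_zero] at key
    exact (ShortComplex.moduleCat_exact_iff _).1 ex.unop _ key.symm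
  · rintro ⟨y, hy⟩
    apply inj
    rw [key, map_zero, ← hy, ← ModuleCat.comp_apply, ← unop_comp, K.iCycles_d]
    rfl

lemma Represents.map (φ : K ⟶ L) {x : (L.X n).unop} {e : (L.homology n).unop}
    (h : L.Represents n x e) :
    K.Represents n ((φ.f n).unop x) ((homologyMap φ n).unop e) := by
  obtain ⟨z, rfl, rfl⟩ := h
  refine ⟨(opcyclesMap φ n).unop z, ?_, ?_⟩
  · rw [← ModuleCat.comp_apply, ← ModuleCat.comp_apply, ← unop_comp, ← unop_comp,
      p_opcyclesMap]
  · rw [← ModuleCat.comp_apply, ← ModuleCat.comp_apply, ← unop_comp, ← unop_comp,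
      homologyι_naturality]

end HomologicalComplex

namespace CategoryTheory.ProjectiveResolution

universe w v u
variable {C : Type u} [Category.{v} C] [Abelian C] [HasExt.{w} C] {X Y : C}

open CochainComplex HomComplex in
lemma extMk_eq_zero_iff_next (P : ProjectiveResolution X) {n : ℕ} (f : P.complex.X n ⟶ Y)
    (hf : P.complex.d (n + 1) n ≫ f = 0) :
    P.extMk f (n + 1) rfl hf = 0 ↔
      ∃ g : P.complex.X ((ComplexShape.down ℕ).next n) ⟶ Y,
        P.complex.d n ((ComplexShape.down ℕ).next n) ≫ g = f := by
  cases n with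
  | succ p =>
    rw [show (ComplexShape.down ℕ).next (p + 1) = p by simp]
    exact P.extMk_eq_zero_iff f _ rfl hf p rfl
  | zero =>
    rw [P.complex.shape 0 _ (by simp), ← P.extEquivCohomologyClass.apply_eq_iff_eq,
      extEquivCohomologyClass_extMk, extEquivCohomologyClass_zero,
      CohomologyClass.mk_eq_zero_iff,
      Cocycle.toSingleMk_mem_coboundaries_iff _ _ _ _ _ 1 (by simp)]
    have hz : IsZero (P.cochainComplex.X 1) :=
      P.cochainComplex.isZero_of_isStrictlyLE 0 1
    constructor
    · rintro ⟨g, hg⟩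
      refine ⟨0, ?_⟩
      rw [hz.eq_of_src g 0, comp_zero, eq_comm] at hg
      rw [← cancel_epi (P.cochainComplexXIso (-(0 : ℕ)) 0 rfl).hom, hg]
      simp
    · rintro ⟨g, hg⟩
      refine ⟨0, ?_⟩
      rw [← hg]
      simp

end CategoryTheory.ProjectiveResolution

section

universe u
variable {R : Type u} [CommRing R] {X Y : ModuleCat.{u} R}

/-- The complex in the opposite category of `R`-modules obtained by applying `Hom(-, M)`
to a projective resolution; its homology computes `Ext`. -/
noncomputable abbrev homComplex (P : ProjectiveResolution X) (M : ModuleCat.{u} R) :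
    HomologicalComplex (ModuleCat.{u} R)ᵒᵖ (ComplexShape.down ℕ) :=
  (((linearYoneda R (ModuleCat.{u} R)).obj M).rightOp.mapHomologicalComplex _).obj P.complex

/-- The class `e` of the derived functor `Ext` is represented by the cocycle `f`. -/
def ExtRepresents (P : ProjectiveResolution X) (M : ModuleCat.{u} R) (n : ℕ)
    (f : P.complex.X n ⟶ M) (e : ((Ext R (ModuleCat.{u} R) n).obj (op X)).obj M) : Prop :=
  (homComplex P M).Represents n f
    ((P.isoLeftDerivedObj ((linearYoneda R (ModuleCat.{u} R)).obj M).rightOp n).inv.unop e)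

variable {P : ProjectiveResolution X} {M : ModuleCat.{u} R} {n : ℕ}

lemma exists_extRepresents (e : ((Ext R (ModuleCat.{u} R) n).obj (op X)).obj M) :
    ∃ f, ExtRepresents P M n f e :=
  HomologicalComplex.exists_represents (homComplex P M) n
    ((P.isoLeftDerivedObj ((linearYoneda R (ModuleCat.{u} R)).obj M).rightOp n).inv.unop e)

lemma ExtRepresents.d_comp {f : P.complex.X n ⟶ M}
    {e : ((Ext R (ModuleCat.{u} R) n).obj (op X)).obj M} (h : ExtRepresents P M n f e) (m : ℕ) :
    P.complex.d m n ≫ f = 0 :=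
  HomologicalComplex.Represents.d_eq_zero h m

lemma exists_extRepresents_of_d_comp {f : P.complex.X n ⟶ M}
    (hf : P.complex.d (n + 1) n ≫ f = 0) : ∃ e, ExtRepresents P M n f e := by
  have hp : (ComplexShape.down ℕ).prev n = n + 1 := by simp
  obtain ⟨e, he⟩ := HomologicalComplex.exists_of_d_eq_zero (K := homComplex P M) (n := n) (x := f)
    (by rw [hp]; exact hf)
  let i := P.isoLeftDerivedObj ((linearYoneda R (ModuleCat.{u} R)).obj M).rightOp n
  refine ⟨i.hom.unop e, ?_⟩
  have hi : i.inv.unop (i.hom.unop e) = e := congrArg (fun j => j.unop e) i.inv_hom_id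
  exact Eq.mpr (congrArg ((homComplex P M).Represents n f) hi) he

lemma ExtRepresents.eq_zero_iff {f : P.complex.X n ⟶ M}
    {e : ((Ext R (ModuleCat.{u} R) n).obj (op X)).obj M} (h : ExtRepresents P M n f e) :
    e = 0 ↔ ∃ g : P.complex.X ((ComplexShape.down ℕ).next n) ⟶ M,
      P.complex.d n ((ComplexShape.down ℕ).next n) ≫ g = f := by
  refine Iff.trans ?_ (HomologicalComplex.Represents.eq_zero_iff h)
  let i := P.isoLeftDerivedObj ((linearYoneda R (ModuleCat.{u} R)).obj M).rightOp n
  have inj : Function.Injective i.inv.unop := (ModuleCat.mono_iff_injective _).1 inferInstance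
  exact ⟨fun h => by rw [h]; exact map_zero i.inv.unop.hom,
    fun h => inj (h.trans (map_zero i.inv.unop.hom).symm)⟩

lemma ExtRepresents.precomp {Q : ProjectiveResolution Y} {f : Q.complex.X n ⟶ M}
    {e : ((Ext R (ModuleCat.{u} R) n).obj (op Y)).obj M} (h : ExtRepresents Q M n f e)
    {x : X ⟶ Y} (φ : P.Hom Q x) :
    ExtRepresents P M n (φ.hom.f n ≫ f) ((((Ext R (ModuleCat.{u} R) n).map x.op).app M) e) := by
  let F := ((linearYoneda R (ModuleCat.{u} R)).obj M).rightOp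
  have h1 := HomologicalComplex.Represents.map ((F.mapHomologicalComplex _).map φ.hom) h
  have h2 := P.isoLeftDerivedObj_inv_naturality x Q φ.hom
    (φ.hom_f_zero_comp_π_f_zero.trans (by simp)) F n
  exact Eq.mpr (congrArg ((homComplex P M).Represents n (φ.hom.f n ≫ f))
    (congrArg (fun j => j.unop e) h2)) h1

end

section

universe u
variable {R : Type u} [CommRing R]

lemma ExtRepresents.precomp_eq_zero_iff {X Y M : ModuleCat.{u} R} {n : ℕ}
    {Q : ProjectiveResolution Y} {f : Q.complex.X n ⟶ M}
    {e : ((Ext R (ModuleCat.{u} R) n).obj (op Y)).obj M} (h : ExtRepresents Q M n f e)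
    (x : X ⟶ Y) :
    (((Ext R (ModuleCat.{u} R) n).map x.op).app M) e = 0 ↔
      (Abelian.Ext.mk₀ x).comp (Q.extMk f (n + 1) rfl (h.d_comp _)) (zero_add n) = 0 := by
  let P := projectiveResolution X
  let φ : P.Hom Q x :=
    ⟨ProjectiveResolution.lift x P Q,
      (ProjectiveResolution.lift_commutes_zero x P Q).trans (by simp)⟩
  rw [(h.precomp φ).eq_zero_iff, ProjectiveResolution.mk₀_comp_extMk f _ rfl (h.d_comp _) φ,
    ProjectiveResolution.extMk_eq_zero_iff_next]

/-- The projection `R ⧸ J ^ s ⟶ R ⧸ J ^ t` for `t ≤ s`. -/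
abbrev powQuotProj (J : Ideal R) {t s : ℕ} (h : t ≤ s) :
    ModuleCat.of R (R ⧸ J ^ s) ⟶ ModuleCat.of R (R ⧸ J ^ t) :=
  ModuleCat.ofHom (Submodule.mapQ _ _ LinearMap.id (Ideal.pow_le_pow_right h))

/-- Every class in `Ext^n(R ⧸ J ^ t, M)` dies in `Ext^n(R ⧸ J ^ s, M)` for some `s ≥ t`. -/
def ExtPowVanishes (J : Ideal R) (n : ℕ) (M : ModuleCat.{u} R) : Prop :=
  ∀ (t : ℕ) (e : Abelian.Ext (ModuleCat.of R (R ⧸ J ^ t)) M n),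
    ∃ (s : ℕ) (h : t ≤ s), (Abelian.Ext.mk₀ (powQuotProj J h)).comp e (zero_add n) = 0

lemma subsingleton_colimit_iff {D : Type} [SmallCategory D] [IsFiltered D]
    (F : D ⥤ ModuleCat.{u} R) :
    Subsingleton (colimit F : ModuleCat.{u} R) ↔
      ∀ (i : D) (x : F.obj i), ∃ (j : D) (f : i ⟶ j), F.map f x = 0 := by
  have := preservesFilteredColimitsOfSize_shrink.{0, u, 0, u} (forget (ModuleCat.{u} R))
  constructor
  · intro h i x
    obtain ⟨k, f, g, hfg⟩ := Concrete.colimit_exists_of_rep_eq F x (0 : F.obj i)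
      (Subsingleton.elim _ _)
    exact ⟨k, f, by rw [hfg, map_zero]⟩
  · intro h
    refine subsingleton_of_forall_eq 0 fun y => ?_
    obtain ⟨i, x, rfl⟩ := Concrete.colimit_exists_rep F y
    obtain ⟨j, f, hf⟩ := h i x
    rw [← colimit.w F f, ModuleCat.comp_apply, hf, map_zero]

open localCohomology in
lemma subsingleton_localCohomology_iff (J : Ideal R) (n : ℕ) (M : ModuleCat.{u} R) :
    Subsingleton ((localCohomology J n).obj M) ↔ ExtPowVanishes J n M := by
  let e := (colimitObjIsoColimitCompEvaluation (diagram (idealPowersDiagram J) n) M)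
  have h1 : Subsingleton ((localCohomology J n).obj M) ↔
      Subsingleton (colimit (diagram (idealPowersDiagram J) n ⋙ (evaluation _ _).obj M) :
        ModuleCat.{u} R) := e.toLinearEquiv.toEquiv.subsingleton_congr
  rw [h1, subsingleton_colimit_iff]
  constructor
  · intro H t e
    let Q := projectiveResolution (ModuleCat.of R (R ⧸ J ^ t))
    obtain ⟨f, hf, rfl⟩ := Q.extMk_surjective e (n + 1) rfl
    obtain ⟨e, he⟩ := exists_extRepresents_of_d_comp hf
    obtain ⟨j, g, hg⟩ := H (op (op t)) e
    exact ⟨j.unop.unop, g.unop.unop.down.down,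
      (he.precomp_eq_zero_iff (powQuotProj J g.unop.unop.down.down)).1 hg⟩
  · intro H i x
    let Q := projectiveResolution (ModuleCat.of R (R ⧸ J ^ i.unop.unop))
    obtain ⟨f, hf⟩ := exists_extRepresents (P := Q) x
    obtain ⟨s, hs, h⟩ := H _ (Q.extMk f (n + 1) rfl (hf.d_comp _))
    exact ⟨op (op s), (homOfLE hs).op.op,
      (hf.precomp_eq_zero_iff (powQuotProj J hs)).2 h⟩

namespace ExtPowVanishes

open Abelian

variable {J : Ideal R} {n : ℕ}

lemma mk₀_powQuotProj_comp {M : ModuleCat.{u} R} {t s s' : ℕ} (h : t ≤ s) (h' : s ≤ s')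
    (e : Ext (ModuleCat.of R (R ⧸ J ^ t)) M n) :
    (Ext.mk₀ (powQuotProj J (h.trans h'))).comp e (zero_add n) =
      (Ext.mk₀ (powQuotProj J h')).comp
        ((Ext.mk₀ (powQuotProj J h)).comp e (zero_add n)) (zero_add n) := by
  rw [Ext.mk₀_comp_mk₀_assoc]
  congr 2
  ext
  rfl

lemma of_subsingleton (M : ModuleCat.{u} R) [Subsingleton M] : ExtPowVanishes J n M := by
  intro t e
  refine ⟨t, le_rfl, ?_⟩
  have h : 𝟙 M = 0 := (ModuleCat.isZero_of_subsingleton M).eq_of_src _ _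
  rw [← Ext.comp_mk₀_id e, h, Ext.mk₀_zero, Ext.comp_zero, Ext.comp_zero]

variable {S : ShortComplex (ModuleCat.{u} R)}

lemma middle (hS : S.ShortExact) (h₁ : ExtPowVanishes J n S.X₁) (h₃ : ExtPowVanishes J n S.X₃) :
    ExtPowVanishes J n S.X₂ := by
  intro t e
  obtain ⟨s, hs, h⟩ := h₃ t (e.comp (Ext.mk₀ S.g) (add_zero n))
  rw [← Ext.comp_assoc_of_third_deg_zero] at h
  obtain ⟨e₁, he₁⟩ := Ext.covariant_sequence_exact₂ _ hS _ h
  obtain ⟨s', hs', h'⟩ := h₁ s e₁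
  refine ⟨s', hs.trans hs', ?_⟩
  rw [mk₀_powQuotProj_comp hs hs', ← he₁, ← Ext.comp_assoc_of_third_deg_zero, h', Ext.zero_comp]

lemma left (hS : S.ShortExact) (h₂ : ExtPowVanishes J n S.X₂)
    (h₃ : ∀ m, m + 1 = n → ExtPowVanishes J m S.X₃) :
    ExtPowVanishes J n S.X₁ := by
  intro t e
  obtain ⟨s, hs, h⟩ := h₂ t (e.comp (Ext.mk₀ S.f) (add_zero n))
  rw [← Ext.comp_assoc_of_third_deg_zero] at h
  cases n with
  | zero =>
    have := hS.mono_f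
    exact ⟨s, hs, Ext.postcomp_mk₀_injective_of_mono _ S.f (h.trans (by simp))⟩
  | succ m =>
    obtain ⟨e₃, he₃⟩ := Ext.covariant_sequence_exact₁ _ hS _ h rfl
    obtain ⟨s', hs', h'⟩ := h₃ m rfl s e₃
    refine ⟨s', hs.trans hs', ?_⟩
    rw [mk₀_powQuotProj_comp hs hs', ← he₃, ← Ext.comp_assoc _ _ _ (zero_add m) rfl (by omega), h',
      Ext.zero_comp]

lemma right (hS : S.ShortExact) (h₂ : ExtPowVanishes J n S.X₂)
    (h₁ : ExtPowVanishes J (n + 1) S.X₁) :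
    ExtPowVanishes J n S.X₃ := by
  intro t e
  obtain ⟨s, hs, h⟩ := h₁ t (e.comp hS.extClass rfl)
  rw [← Ext.comp_assoc _ _ _ (zero_add n) rfl (by omega)] at h
  obtain ⟨e₂, he₂⟩ := Ext.covariant_sequence_exact₃ _ hS _ rfl h
  obtain ⟨s', hs', h'⟩ := h₂ s e₂
  refine ⟨s', hs.trans hs', ?_⟩
  rw [mk₀_powQuotProj_comp hs hs', ← he₂, ← Ext.comp_assoc_of_third_deg_zero, h', Ext.zero_comp]

lemma exists_isSMulRegular [IsNoetherianRing R] {M : ModuleCat.{u} R} [Module.Finite R M]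
    (h : ExtPowVanishes J 0 M) : ∃ x ∈ J, IsSMulRegular M x := by
  have key : Subsingleton ((R ⧸ J ^ 1) →ₗ[R] M) := by
    refine subsingleton_of_forall_eq 0 fun f => ?_
    obtain ⟨s, hs, h⟩ := h 1 (Ext.mk₀ (ModuleCat.ofHom f))
    rw [Ext.mk₀_comp_mk₀, Ext.mk₀_eq_zero_iff] at h
    have : Epi (powQuotProj J hs) := by
      rw [ModuleCat.epi_iff_surjective]
      rintro ⟨y⟩
      exact ⟨Submodule.Quotient.mk y, rfl⟩
    rw [← comp_zero, cancel_epi] at h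
    exact congrArg ModuleCat.Hom.hom h
  obtain ⟨x, hx, hreg⟩ := IsSMulRegular.subsingleton_linearMap_iff.1 key
  rw [Ideal.annihilator_quotient, pow_one] at hx
  exact ⟨x, hx, hreg⟩

end ExtPowVanishes

lemma smul_top_sup_eq_top_of_quotient {M : Type*} [AddCommGroup M] [Module R M] (J : Ideal R)
    (K : Submodule R M) (h : J • (⊤ : Submodule R (M ⧸ K)) = ⊤) :
    J • (⊤ : Submodule R M) ⊔ K = ⊤ := by
  have hmap : J • (⊤ : Submodule R (M ⧸ K)) = (J • (⊤ : Submodule R M)).map K.mkQ := by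
    rw [Submodule.map_smul'', Submodule.map_top, Submodule.range_mkQ]
  have hcomap := congrArg (Submodule.comap K.mkQ) (hmap.symm.trans h)
  rwa [Submodule.comap_map_eq, Submodule.ker_mkQ, Submodule.comap_top] at hcomap

open scoped Pointwise in
/-- Local cohomology detects finite modules `M` with `J M ≠ M`. -/
lemma exists_not_extPowVanishes [IsNoetherianRing R] (J : Ideal R) (M : ModuleCat.{u} R)
    [Module.Finite R M] (hM : J • (⊤ : Submodule R M) ≠ ⊤) :
    ∃ n, ¬ ExtPowVanishes J n M := by
  suffices H : ∀ (N : Submodule R M) (Q : ModuleCat.{u} R) (f : M →ₗ[R] Q),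
      Function.Surjective f → LinearMap.ker f = N → J • (⊤ : Submodule R Q) ≠ ⊤ →
      ∃ n, ¬ ExtPowVanishes J n Q from
    H ⊥ M LinearMap.id Function.surjective_id LinearMap.ker_id hM
  intro N
  induction N using WellFoundedGT.induction with
  | ind N ih =>
    intro Q f hf hN hQ
    have : Module.Finite R Q := Module.Finite.of_surjective f hf
    by_contra! H
    obtain ⟨x, hx, hreg⟩ := (H 0).exists_isSMulRegular
    have hS := hreg.smulShortComplex_shortExact
    let π : Q →ₗ[R] QuotSMulTop x Q := Submodule.mkQ _
    have hπ : Function.Surjective π := Submodule.mkQ_surjective _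
    have hker : LinearMap.ker f ≤ LinearMap.ker (π ∘ₗ f) := LinearMap.ker_le_ker_comp f π
    have hne : N < LinearMap.ker (π ∘ₗ f) := by
      refine lt_of_le_of_ne (hN ▸ hker) fun heq => hQ ?_
      have hxQ : x • (⊤ : Submodule R Q) = ⊥ := by
        rw [eq_bot_iff]
        intro q hq
        obtain ⟨m, rfl⟩ := hf q
        have : m ∈ LinearMap.ker (π ∘ₗ f) := (Submodule.Quotient.mk_eq_zero _).2 hq
        rw [← heq, ← hN] at this
        exact this
      rw [eq_top_iff]
      intro q _
      have hq : q = 0 := hreg (by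
        have : x • q ∈ x • (⊤ : Submodule R Q) := Submodule.smul_mem_pointwise_smul _ _ _ trivial
        rw [hxQ, Submodule.mem_bot] at this
        change x • q = x • (0 : Q)
        rw [this, smul_zero])
      rw [hq]
      exact zero_mem _
    obtain ⟨n, hn⟩ := ih _ hne (ModuleCat.of R (QuotSMulTop x Q)) (π ∘ₗ f) (hπ.comp hf) rfl (by
      intro htop
      apply hQ
      refine (sup_eq_left.2 ?_).symm.trans (smul_top_sup_eq_top_of_quotient J _ htop)
      rintro _ ⟨q, -, rfl⟩
      exact Submodule.smul_mem_smul hx trivial)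
    exact hn (ExtPowVanishes.right hS (H n) (H (n + 1)))

end

namespace PaperHTT

section

universe u
variable {R : Type u} [CommRing R]

/-- The sequence `0 → p/q → R/q → R/p → 0` for ideals `q ≤ p`. -/
abbrev quotientShortComplex {p q : Ideal R} (h : q ≤ p) : ShortComplex (ModuleCat.{u} R) where
  X₁ := ModuleCat.of R (p ⧸ Submodule.comap p.subtype q)
  X₂ := ModuleCat.of R (R ⧸ q)
  X₃ := ModuleCat.of R (R ⧸ p)
  f := ModuleCat.ofHom (Submodule.mapQ _ _ p.subtype le_rfl)
  g := ModuleCat.ofHom (Submodule.mapQ _ _ LinearMap.id h)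
  zero := by
    ext x
    exact (Submodule.Quotient.mk_eq_zero p).2 x.2

lemma quotientShortComplex_shortExact {p q : Ideal R} (h : q ≤ p) :
    (quotientShortComplex h).ShortExact where
  exact := by
    rw [ShortComplex.moduleCat_exact_iff]
    rintro ⟨x⟩ hx
    exact ⟨Submodule.Quotient.mk ⟨x, (Submodule.Quotient.mk_eq_zero p).1 hx⟩, rfl⟩
  mono_f := by
    rw [ModuleCat.mono_iff_injective, injective_iff_map_eq_zero]
    rintro ⟨x⟩ hx
    exact (Submodule.Quotient.mk_eq_zero _).2 ((Submodule.Quotient.mk_eq_zero q).1 hx)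
  epi_g := by
    rw [ModuleCat.epi_iff_surjective]
    rintro ⟨x⟩
    exact ⟨Submodule.Quotient.mk x, rfl⟩

end

variable {k : Type} [Field k] {σ : Type}

lemma le_depthM_iff {M : ModuleCat (MvPolynomial σ k)}
    (hM : ∃ n, ¬ ExtPowVanishes (maxHomIdeal k σ) n M) (d : ℕ) :
    d ≤ depthM k M ↔ ∀ n < d, ExtPowVanishes (maxHomIdeal k σ) n M := by
  have hset : {i : ℕ | Nontrivial ((localCohomology (maxHomIdeal k σ) i).obj M)} =
      {i | ¬ ExtPowVanishes (maxHomIdeal k σ) i M} := by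
    ext i
    rw [Set.mem_ofPred_eq, Set.mem_ofPred_eq, ← subsingleton_localCohomology_iff,
      not_subsingleton_iff_nontrivial]
  rw [depthM, hset]
  have hne : {i | ¬ ExtPowVanishes (maxHomIdeal k σ) i M}.Nonempty := hM
  rw [le_csInf_iff (OrderBot.bddBelow _) hne]
  refine forall_congr' fun n => ?_
  rw [Set.mem_ofPred_eq, ← not_lt]
  tauto

lemma mem_maxHomIdeal_iff {f : MvPolynomial σ k} :
    f ∈ maxHomIdeal k σ ↔ MvPolynomial.constantCoeff f = 0 := by
  rw [maxHomIdeal, ← MvPolynomial.idealOfVars, ← pow_one (MvPolynomial.idealOfVars _ _),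
    MvPolynomial.mem_pow_idealOfVars_iff', MvPolynomial.constantCoeff_eq]
  simp [Finsupp.degree_eq_zero_iff]

lemma maxHomIdeal_ne_top : maxHomIdeal k σ ≠ ⊤ := by
  rw [Ne, Ideal.eq_top_iff_one, mem_maxHomIdeal_iff, map_one]
  exact one_ne_zero

lemma IsHomogeneousIdeal.le_maxHomIdeal {I : Ideal (MvPolynomial σ k)}
    (hI : IsHomogeneousIdeal k I) (hI1 : I ≠ ⊤) : I ≤ maxHomIdeal k σ := by
  intro f hf
  rw [mem_maxHomIdeal_iff]
  by_contra hne
  have h0 := hI f hf 0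
  rw [MvPolynomial.homogeneousComponent_zero] at h0
  exact hI1 (Ideal.eq_top_of_isUnit_mem _ h0 ((isUnit_iff_ne_zero.2 hne).map MvPolynomial.C))

variable [Finite σ]

lemma exists_not_extPowVanishes_quotient {Q : Ideal (MvPolynomial σ k)}
    (hQ : Q ≤ maxHomIdeal k σ) :
    ∃ n, ¬ ExtPowVanishes (maxHomIdeal k σ) n
      (ModuleCat.of (MvPolynomial σ k) (MvPolynomial σ k ⧸ Q)) := by
  apply exists_not_extPowVanishes
  intro h
  have h1 := smul_top_sup_eq_top_of_quotient _ Q h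
  rw [Ideal.smul_eq_mul, Ideal.mul_top, sup_eq_left.2 hQ] at h1
  exact maxHomIdeal_ne_top h1

lemma exists_not_extPowVanishes_subQuot {p q : Ideal (MvPolynomial σ k)}
    (hp : p ≠ ⊥) (hq : q ≤ maxHomIdeal k σ * p) :
    ∃ n, ¬ ExtPowVanishes (maxHomIdeal k σ) n
      (ModuleCat.of (MvPolynomial σ k) (subQuot k p q)) := by
  apply exists_not_extPowVanishes
  intro h
  have h1 := congrArg (Submodule.map p.subtype) (smul_top_sup_eq_top_of_quotient _ _ h)
  rw [Submodule.map_sup, Submodule.map_smul'', Submodule.map_top, Submodule.range_subtype] at h1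
  have h2 : p ≤ maxHomIdeal k σ • p := by
    conv_lhs => rw [← h1]
    exact sup_le le_rfl ((Submodule.map_comap_le _ _).trans hq)
  obtain ⟨a, ha, hap⟩ := Submodule.exists_sub_one_mem_and_smul_eq_zero_of_fg_of_le_smul
    (maxHomIdeal k σ) p (IsNoetherian.noetherian p) h2
  obtain ⟨x, hx, hx0⟩ := Submodule.exists_mem_ne_zero_of_ne_bot hp
  have ha0 : a = 0 := (mul_eq_zero.1 (hap x hx)).resolve_right hx0
  rw [ha0, zero_sub, neg_mem_iff, ← Ideal.eq_top_iff_one] at ha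
  exact maxHomIdeal_ne_top ha

end PaperHTT

end

open PaperHTT in
/-- Lemma 4.4: `min_(i ≥ 1) depth A/I^i = min_(i ≥ 1) depth I^(i-1)/I^i`. -/
theorem min_depth_quot_eq_min_depth_successive
    (k : Type) [Field k] (r : ℕ) (I : Ideal (PA k r))
    (hI0 : I ≠ ⊥) (hI1 : I ≠ ⊤) (hIh : IsHomogeneousIdeal k I) :
    sInf {v : ℕ | ∃ i, 1 ≤ i ∧ v = depthQuot k (I ^ i)} =
      sInf {v : ℕ | ∃ i, 1 ≤ i ∧ v = depthSubQuot k (I ^ (i - 1)) (I ^ i)} := by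
  have hIm := hIh.le_maxHomIdeal hI1
  have hQ (j : ℕ) := exists_not_extPowVanishes_quotient
    ((Ideal.pow_le_self j.succ_ne_zero).trans hIm)
  have hS (j : ℕ) := exists_not_extPowVanishes_subQuot (pow_ne_zero j hI0 : I ^ j ≠ ⊥)
    (q := I ^ (j + 1)) (by rw [pow_succ']; exact Ideal.mul_mono_left hIm)
  have hex (j : ℕ) := quotientShortComplex_shortExact (Ideal.pow_le_pow_right j.le_succ :
    I ^ (j + 1) ≤ I ^ j)
  have hzero (n : ℕ) : ExtPowVanishes (maxHomIdeal k (Fin r)) n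
      (ModuleCat.of (PA k r) (PA k r ⧸ I ^ 0)) := by
    have : Subsingleton (PA k r ⧸ I ^ 0) := by
      rw [pow_zero, Ideal.one_eq_top]
      infer_instance
    exact .of_subsingleton _
  apply le_antisymm
  · refine le_csInf ⟨depthSubQuot k (I ^ (1 - 1)) (I ^ 1), 1, le_rfl, rfl⟩ ?_
    rintro _ ⟨i, hi, rfl⟩
    obtain ⟨j, rfl⟩ := Nat.exists_eq_add_of_le' hi
    have hle (j : ℕ) : sInf {v : ℕ | ∃ i, 1 ≤ i ∧ v = depthQuot k (I ^ i)} ≤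
        depthQuot k (I ^ (j + 1)) := Nat.sInf_le ⟨j + 1, by omega, rfl⟩
    have H (j : ℕ) := (le_depthM_iff (hQ j) _).1 (hle j)
    refine (le_depthM_iff (hS j) _).2 fun n hn =>
      ExtPowVanishes.left (hex j) (H j n hn) fun m hm => ?_
    cases j with
    | zero => exact hzero m
    | succ j => exact H j m (by omega)
  · refine le_csInf ⟨depthQuot k (I ^ 1), 1, le_rfl, rfl⟩ ?_
    rintro _ ⟨i, hi, rfl⟩
    obtain ⟨j, rfl⟩ := Nat.exists_eq_add_of_le' hi
    have hle (j : ℕ) : sInf {v : ℕ | ∃ i, 1 ≤ i ∧ v = depthSubQuot k (I ^ (i - 1)) (I ^ i)} ≤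
        depthSubQuot k (I ^ j) (I ^ (j + 1)) := Nat.sInf_le ⟨j + 1, by omega, rfl⟩
    have H (j : ℕ) := (le_depthM_iff (hS j) _).1 (hle j)
    refine (le_depthM_iff (hQ j) _).2 fun n hn => ?_
    have hall : ∀ j, ExtPowVanishes (maxHomIdeal k (Fin r)) n
        (ModuleCat.of (PA k r) (PA k r ⧸ I ^ j)) := by
      intro j
      induction j with
      | zero => exact hzero n
      | succ j ih => exact .middle (hex j) (H j n hn) ih
    exact hall (j + 1)
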